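/- Let C = [C_1,…,C_r] be the W-characteristic set of ⟨P⟩. If C is a regular set, then C* = [C_1, prem(C_2,[C_1]), …, prem(C_r,[C_1,…,C_{r−1}])] is a Ritt characteristic set of ⟨P⟩, and moreover C* is itself a regular set. -/

import Mathlib

open MvPolynomial

namespace CharSets

variable {n : ℕ} {K : Type*} [Field K]

/-- The coefficient of `x_i ^ d` in `F`, as a polynomial in the remaining variables. -/
noncomputable def coefv (i : Fin n) (d : ℕ) (F : MvPolynomial (Fin n) K) :
    MvPolynomial (Fin n) K :=
  ∑ m ∈ F.support.filter (fun m => m i = d), monomial (Finsupp.erase i m) (F.coeff m)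

/-- The leading coefficient of `F` with respect to the variable `x_i`. -/
noncomputable def lcv (i : Fin n) (F : MvPolynomial (Fin n) K) : MvPolynomial (Fin n) K :=
  coefv i (F.degreeOf i) F

/-- Auxiliary pseudo-division: computes (pseudo-quotient, pseudo-remainder) pairs,
with the first argument as fuel; the total power of the leading coefficient used is
exactly the fuel, so that starting with fuel `max(l - m + 1, 0)` yields the pair
`(Q, R)` of the unique representation `lc(F,x_i)^q • G = Q*F + R` with
`q = max(l - m + 1, 0)` and `deg(R, x_i) < deg(F, x_i)`. -/
noncomputable def pdivAux (i : Fin n) (F : MvPolynomial (Fin n) K) :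
    ℕ → MvPolynomial (Fin n) K × MvPolynomial (Fin n) K →
      MvPolynomial (Fin n) K × MvPolynomial (Fin n) K
  | 0, QR => QR
  | q + 1, QR =>
    if (QR.2).degreeOf i < F.degreeOf i then
      (lcv i F ^ (q + 1) * QR.1, lcv i F ^ (q + 1) * QR.2)
    else
      pdivAux i F q
        (lcv i F * QR.1 +
            coefv i ((QR.2).degreeOf i) QR.2 * X i ^ ((QR.2).degreeOf i - F.degreeOf i),
          lcv i F * QR.2 -
            coefv i ((QR.2).degreeOf i) QR.2 * X i ^ ((QR.2).degreeOf i - F.degreeOf i) * F)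

/-- The pseudo-remainder `prem(G, F, x_i)`. -/
noncomputable def prem (G F : MvPolynomial (Fin n) K) (i : Fin n) : MvPolynomial (Fin n) K :=
  (pdivAux i F (G.degreeOf i + 1 - F.degreeOf i) (0, G)).2

/-- The pseudo-quotient `pquo(G, F, x_i)`. -/
noncomputable def pquo (G F : MvPolynomial (Fin n) K) (i : Fin n) : MvPolynomial (Fin n) K :=
  (pdivAux i F (G.degreeOf i + 1 - F.degreeOf i) (0, G)).1

/-- The class of `P`: the largest index (1-based) of a variable actually occurring in `P`;
the class of a constant is `0`. -/
noncomputable def cls (P : MvPolynomial (Fin n) K) : ℕ :=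
  P.vars.sup fun i => (i : ℕ) + 1

/-- The degree of `G` in the leading variable of `P` (`0` if `P` is constant). -/
noncomputable def degLv (G P : MvPolynomial (Fin n) K) : ℕ :=
  if h : P.vars.Nonempty then G.degreeOf (P.vars.max' h) else 0

/-- `G` is R-reduced with respect to `P`, i.e. `deg(G, lv(P)) < deg(P, lv(P))`. -/
def RReduced (G P : MvPolynomial (Fin n) K) : Prop :=
  degLv G P < degLv P P

/-- The initial of `P`: its leading coefficient w.r.t. its leading variable. -/
noncomputable def ini (P : MvPolynomial (Fin n) K) : MvPolynomial (Fin n) K :=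
  if h : P.vars.Nonempty then lcv (P.vars.max' h) P else P

/-- Pseudo-remainder of `G` w.r.t. `F` in the leading variable of `F`
(in case `F` is constant, `m = 0` and the pseudo-remainder is `0`). -/
noncomputable def premLv (G F : MvPolynomial (Fin n) K) : MvPolynomial (Fin n) K :=
  if h : F.vars.Nonempty then prem G F (F.vars.max' h) else 0

/-- Pseudo-quotient of `G` w.r.t. `F` in the leading variable of `F`. -/
noncomputable def pquoLv (G F : MvPolynomial (Fin n) K) : MvPolynomial (Fin n) K :=
  if h : F.vars.Nonempty then pquo G F (F.vars.max' h) else 0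

/-- Iterated pseudo-remainder with respect to a triangular set `[T_1, …, T_r]`:
`prem(P, T) = prem(⋯prem(P, T_r, lv(T_r)), …, T_1, lv(T_1))`. -/
noncomputable def premTS (P : MvPolynomial (Fin n) K) (L : List (MvPolynomial (Fin n) K)) :
    MvPolynomial (Fin n) K :=
  L.foldr (fun T acc => premLv acc T) P

/-- The Sylvester matrix of `F` and `G` with respect to the variable `x_i`. -/
noncomputable def sylvester (i : Fin n) (F G : MvPolynomial (Fin n) K) :
    Matrix (Fin (G.degreeOf i + F.degreeOf i)) (Fin (G.degreeOf i + F.degreeOf i))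
      (MvPolynomial (Fin n) K) :=
  Matrix.of fun r c =>
    if (r : ℕ) < G.degreeOf i then
      if (r : ℕ) ≤ (c : ℕ) ∧ (c : ℕ) ≤ (r : ℕ) + F.degreeOf i then
        coefv i (F.degreeOf i + (r : ℕ) - (c : ℕ)) F
      else 0
    else
      if (r : ℕ) - G.degreeOf i ≤ (c : ℕ) ∧ (c : ℕ) ≤ (r : ℕ) then
        coefv i (G.degreeOf i + ((r : ℕ) - G.degreeOf i) - (c : ℕ)) G
      else 0

/-- The resultant `res(F, G, x_i)` of `F` and `G` w.r.t. `x_i`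
(the determinant of the Sylvester matrix). -/
noncomputable def resv (F G : MvPolynomial (Fin n) K) (i : Fin n) : MvPolynomial (Fin n) K :=
  (sylvester i F G).det

/-- Resultant of `F` and `G` w.r.t. the leading variable of `G`. -/
noncomputable def resLv (F G : MvPolynomial (Fin n) K) : MvPolynomial (Fin n) K :=
  if h : G.vars.Nonempty then resv F G (G.vars.max' h) else F

/-- Iterated resultant with respect to a triangular set:
`res(F, T) = res(⋯res(F, T_r, lv(T_r)), …, T_1, lv(T_1))`. -/
noncomputable def resTS (F : MvPolynomial (Fin n) K) (L : List (MvPolynomial (Fin n) K)) :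
    MvPolynomial (Fin n) K :=
  L.foldr (fun T acc => resLv acc T) F

/-- A triangular set: a nonempty ordered set of nonconstant polynomials with
strictly increasing classes. -/
def TriangularSet (L : List (MvPolynomial (Fin n) K)) : Prop :=
  L ≠ [] ∧ (∀ T ∈ L, 0 < cls T) ∧ L.Chain' fun A B => cls A < cls B

/-- An ascending set: either a single nonzero constant, or a triangular set in which
every later element is R-reduced with respect to every earlier one. -/
def AscendingSet (L : List (MvPolynomial (Fin n) K)) : Prop :=
  (∃ a : K, a ≠ 0 ∧ L = [MvPolynomial.C a]) ∨
    (TriangularSet L ∧ L.Pairwise fun A B => RReduced B A)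

/-- `F` has lower rank than `G`. -/
def rkLT (F G : MvPolynomial (Fin n) K) : Prop :=
  cls F < cls G ∨ (cls F = cls G ∧ 0 < cls F ∧ degLv F F < degLv G G)

/-- `F` and `G` have the same rank: neither has lower rank than the other. -/
def rkEQ (F G : MvPolynomial (Fin n) K) : Prop :=
  ¬ rkLT F G ∧ ¬ rkLT G F

/-- `B` has lower rank than `A` (as ascending sets). -/
def ascLT (B A : List (MvPolynomial (Fin n) K)) : Prop :=
  (∃ j, j < min A.length B.length ∧
      (∀ i, i < j → rkEQ (A.getD i 0) (B.getD i 0)) ∧ rkLT (B.getD j 0) (A.getD j 0)) ∨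
    (A.length < B.length ∧ ∀ i, i < A.length → rkEQ (A.getD i 0) (B.getD i 0))

/-- A Ritt characteristic set of the ideal `I`: an ascending set contained in `I`
of minimal rank among all ascending sets contained in `I`. -/
def RittCharSet (I : Ideal (MvPolynomial (Fin n) K)) (A : List (MvPolynomial (Fin n) K)) :
    Prop :=
  AscendingSet A ∧ (∀ a ∈ A, a ∈ I) ∧
    ∀ B : List (MvPolynomial (Fin n) K), AscendingSet B → (∀ b ∈ B, b ∈ I) → ¬ ascLT B A

/-- The saturated ideal of a triangular set, as a set of polynomials. -/
def satTS (L : List (MvPolynomial (Fin n) K)) : Set (MvPolynomial (Fin n) K) :=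
  {F | ∃ q : ℕ, 0 < q ∧ (L.map ini).prod ^ q * F ∈ Ideal.span {T | T ∈ L}}

/-- A regular set: a triangular set such that `res(ini(T_j), [T_1, …, T_{j-1}]) ≠ 0`
for `j = 2, …, r`. -/
def RegularSet (L : List (MvPolynomial (Fin n) K)) : Prop :=
  TriangularSet L ∧
    ∀ j : ℕ, 0 < j → j < L.length → resTS (ini (L.getD j 0)) (L.take j) ≠ 0

/-- A normal triangular set: `deg(ini(T_j), lv(T_i)) = 0` for all `i < j`. -/
def NormalSet (L : List (MvPolynomial (Fin n) K)) : Prop :=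
  TriangularSet L ∧ L.Pairwise fun A B => degLv (ini B) A = 0

/-- The purely lexicographical order on monomials determined by `x_1 < ⋯ < x_n`. -/
def plexLT (a b : Fin n →₀ ℕ) : Prop :=
  ∃ k : Fin n, a k < b k ∧ ∀ j : Fin n, k < j → a j = b j

/-- `m` is the leading monomial of `P` w.r.t. the plex order. -/
def IsLpp (P : MvPolynomial (Fin n) K) (m : Fin n →₀ ℕ) : Prop :=
  m ∈ P.support ∧ ∀ m' ∈ P.support, m' ≠ m → plexLT m' m

/-- `G` is the reduced (Buchberger–)Gröbner basis of the ideal `I` w.r.t. the plex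
term order determined by `x_1 < ⋯ < x_n`: its elements are nonzero monic members of `I`,
the leading monomial of every nonzero member of `I` is divisible by the leading monomial
of some element of `G`, every element of `G` is B-reduced w.r.t. the others, and `G`
generates `I`. -/
def IsReducedGB (I : Ideal (MvPolynomial (Fin n) K)) (G : Finset (MvPolynomial (Fin n) K)) :
    Prop :=
  (∀ g ∈ G, g ∈ I ∧ g ≠ 0 ∧ ∀ m, IsLpp g m → g.coeff m = 1) ∧
    (∀ F ∈ I, F ≠ 0 → ∃ g ∈ G, ∃ mg mF, IsLpp g mg ∧ IsLpp F mF ∧ mg ≤ mF) ∧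
    (∀ g ∈ G, ∀ g' ∈ G, g' ≠ g → ∀ m ∈ g.support, ∀ m', IsLpp g' m' → ¬ m' ≤ m) ∧
    Ideal.span (G : Set (MvPolynomial (Fin n) K)) = I

/-- `Cs` is the W-characteristic set of `I`: the minimal triangular set contained in the
reduced plex Gröbner basis `G` of `I`, i.e. for each class realized in `G`, `Cs` contains
the element of that class whose leading monomial is minimal w.r.t. the plex order, the
elements being ordered by increasing class (equivalently, by the plex order). -/
def IsWCharSet (I : Ideal (MvPolynomial (Fin n) K)) (Cs : List (MvPolynomial (Fin n) K)) :
    Prop :=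
  ∃ G : Finset (MvPolynomial (Fin n) K), IsReducedGB I G ∧
    (Cs.Chain' fun A B => cls A < cls B) ∧
    (∀ c ∈ Cs, c ∈ G) ∧
    (∀ g ∈ G, ∃ c ∈ Cs, cls c = cls g) ∧
    ∀ c ∈ Cs, ∀ g ∈ G, cls g = cls c → g ≠ c →
      ∃ mc mg, IsLpp c mc ∧ IsLpp g mg ∧ plexLT mc mg

/-- The set of common zeros of a set `S` of polynomials over `k`, taken in `Kc ^ n`
for an extension `Kc` of `k`. -/
def zeroSet {k : Type*} [Field k] (Kc : Type*) [CommRing Kc] [Algebra k Kc]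
    (S : Set (MvPolynomial (Fin n) k)) : Set (Fin n → Kc) :=
  {a | ∀ p ∈ S, MvPolynomial.aeval a p = 0}


/-- Specialise every variable except `x_i` at `a`, keeping `x_i` as a polynomial variable. -/
noncomputable def partialEval {R : Type*} [CommRing R] [Algebra K R] (a : Fin n → R) (i : Fin n) :
    MvPolynomial (Fin n) K →ₐ[K] Polynomial R :=
  aeval fun j => if j = i then Polynomial.X else Polynomial.C (a j)

section PartialEval

variable {R : Type*} [CommRing R] [Algebra K R] (a : Fin n → R) (i : Fin n)

lemma partialEval_monomial (m : Fin n →₀ ℕ) (c : K) :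
    partialEval a i (monomial m c) =
      Polynomial.C (aeval a (monomial (Finsupp.erase i m) c)) * Polynomial.X ^ m i := by
  classical
  have h1 : ∀ (b : Fin n → Polynomial R) (m : Fin n →₀ ℕ),
      m.prod (fun j k => b j ^ k) = ∏ j, b j ^ m j := fun b m =>
    Finsupp.prod_fintype _ _ (by simp)
  have h2 : ∀ (m : Fin n →₀ ℕ), m.prod (fun j k => a j ^ k) = ∏ j, a j ^ m j := fun m =>
    Finsupp.prod_fintype _ _ (by simp)
  rw [partialEval, aeval_monomial, aeval_monomial, h1, h2, ← Finset.mul_prod_erase _ _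
    (Finset.mem_univ i), ← Finset.mul_prod_erase Finset.univ (fun j => a j ^ _)
    (Finset.mem_univ i)]
  rw [Finset.prod_congr rfl (g := fun j => Polynomial.C (a j ^ (Finsupp.erase i m) j))]
  · simp only [if_true, Finsupp.erase_same, pow_zero, one_mul, map_mul, map_prod]
    rw [IsScalarTower.algebraMap_apply K R (Polynomial R), Polynomial.algebraMap_eq]
    ring
  · intro j hj
    have hj' := Finset.ne_of_mem_erase hj
    simp [hj']

lemma coeff_partialEval (F : MvPolynomial (Fin n) K) (d : ℕ) :
    (partialEval a i F).coeff d = aeval a (coefv i d F) := by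
  conv_lhs => rw [F.as_sum]
  rw [map_sum, Polynomial.finsetSum_coeff, coefv, map_sum, Finset.sum_filter]
  refine Finset.sum_congr rfl fun m _ => ?_
  rw [partialEval_monomial, Polynomial.coeff_C_mul_X_pow]
  simp only [eq_comm]

lemma eval_partialEval (F : MvPolynomial (Fin n) K) (b : R) :
    (partialEval a i F).eval b = aeval (Function.update a i b) F := by
  classical
  have : ((Polynomial.aeval b).restrictScalars K).comp (partialEval a i) =
      aeval (Function.update a i b) := by
    refine MvPolynomial.algHom_ext fun j => ?_
    by_cases h : j = i
    · subst h; simp [partialEval]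
    · simp [partialEval, h]
  rw [← this]
  simp

lemma coefv_eq_zero {F : MvPolynomial (Fin n) K} {i : Fin n} {d : ℕ} (h : F.degreeOf i < d) :
    coefv i d F = 0 := by
  rw [coefv, Finset.filter_eq_empty_iff.2, Finset.sum_empty]
  intro m hm hd
  have := monomial_le_degreeOf i hm
  omega

lemma coeff_coefv (F : MvPolynomial (Fin n) K) (i : Fin n) {m : Fin n →₀ ℕ} :
    (coefv i (m i) F).coeff (Finsupp.erase i m) = F.coeff m := by
  classical
  rw [coefv, coeff_sum]
  by_cases hm : m ∈ F.support
  · refine (Finset.sum_eq_single m ?_ ?_).trans (by simp)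
    · intro m' hm' hne
      rw [coeff_monomial, if_neg]
      intro he
      refine hne (Finsupp.ext fun j => ?_)
      by_cases hj : j = i
      · subst hj; exact (Finset.mem_filter.1 hm').2
      · simpa [hj] using DFunLike.congr_fun he j
    · intro h
      exact (h (Finset.mem_filter.2 ⟨hm, rfl⟩)).elim
  · rw [notMem_support_iff.1 hm]
    refine Finset.sum_eq_zero fun m' hm' => ?_
    rw [coeff_monomial, if_neg]
    intro he
    have : m' = m := Finsupp.ext fun j => by
      by_cases hj : j = i
      · subst hj; exact (Finset.mem_filter.1 hm').2
      · simpa [hj] using DFunLike.congr_fun he j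
    exact hm (this ▸ (Finset.mem_filter.1 hm').1)

lemma degreeOf_coefv_le (F : MvPolynomial (Fin n) K) (i j : Fin n) (d : ℕ) :
    (coefv i d F).degreeOf j ≤ F.degreeOf j := by
  classical
  refine (degreeOf_sum_le _ _ _).trans (Finset.sup_le fun m hm => ?_)
  have hm := (Finset.mem_filter.1 hm).1
  rw [degreeOf_monomial_eq _ _ (mem_support_iff.1 hm)]
  refine le_trans ?_ (monomial_le_degreeOf j hm)
  rw [Finsupp.erase_apply]
  split_ifs <;> simp

lemma degreeOf_coefv_self (F : MvPolynomial (Fin n) K) (i : Fin n) (d : ℕ) :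
    (coefv i d F).degreeOf i = 0 := by
  refine Nat.le_zero.1 ((degreeOf_sum_le _ _ _).trans (Finset.sup_le fun m hm => ?_))
  have hm := (Finset.mem_filter.1 hm).1
  rw [degreeOf_monomial_eq _ _ (mem_support_iff.1 hm)]
  simp

lemma coefv_zero_of_degreeOf_eq_zero {F : MvPolynomial (Fin n) K} {i : Fin n}
    (h : F.degreeOf i = 0) : coefv i 0 F = F := by
  have hm : ∀ m ∈ F.support, m i = 0 := fun m hm => by
    have := monomial_le_degreeOf i hm
    omega
  conv_rhs => rw [F.as_sum]
  rw [coefv, Finset.filter_true_of_mem hm]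
  refine Finset.sum_congr rfl fun m h' => ?_
  rw [Finsupp.erase_of_notMem_support]
  simpa using hm m h'

lemma natDegree_partialEval_le (F : MvPolynomial (Fin n) K) :
    (partialEval a i F).natDegree ≤ F.degreeOf i := by
  refine Polynomial.natDegree_le_iff_coeff_eq_zero.2 fun d hd => ?_
  rw [coeff_partialEval, coefv_eq_zero hd, map_zero]

lemma partialEval_of_degreeOf_eq_zero {F : MvPolynomial (Fin n) K} {i : Fin n}
    (h : F.degreeOf i = 0) : partialEval a i F = Polynomial.C (aeval a F) := by
  have := natDegree_partialEval_le a i F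
  rw [Polynomial.eq_C_of_natDegree_eq_zero (p := partialEval a i F) (by omega),
    coeff_partialEval, coefv_zero_of_degreeOf_eq_zero h]

lemma aeval_update_of_degreeOf_eq_zero {F : MvPolynomial (Fin n) K} {i : Fin n}
    (h : F.degreeOf i = 0) (b : R) : aeval (Function.update a i b) F = aeval a F := by
  rw [← eval_partialEval, partialEval_of_degreeOf_eq_zero a h, Polynomial.eval_C]

lemma lcv_ne_zero {F : MvPolynomial (Fin n) K} {i : Fin n} (h : 0 < F.degreeOf i) :
    lcv i F ≠ 0 := by
  obtain ⟨m, hm, hmi⟩ : ∃ m ∈ F.support, F.degreeOf i ≤ m i := by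
    by_contra! hlt
    exact absurd ((degreeOf_lt_iff h).2 hlt) (lt_irrefl _)
  have hmi : m i = F.degreeOf i := le_antisymm (monomial_le_degreeOf i hm) hmi
  intro h0
  rw [lcv, ← hmi] at h0
  have := coeff_coefv F i (m := m)
  rw [h0, coeff_zero] at this
  exact mem_support_iff.1 hm this.symm

lemma natDegree_partialEval_X (F : MvPolynomial (Fin n) K) :
    (partialEval (X : Fin n → MvPolynomial (Fin n) K) i F).natDegree = F.degreeOf i := by
  refine le_antisymm (natDegree_partialEval_le _ _ _) ?_
  rcases Nat.eq_zero_or_pos (F.degreeOf i) with h | h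
  · omega
  · refine Polynomial.le_natDegree_of_ne_zero ?_
    rw [coeff_partialEval, aeval_X_left_apply]
    exact lcv_ne_zero h

end PartialEval

lemma degreeOf_lcv_le (F : MvPolynomial (Fin n) K) (i j : Fin n) :
    (lcv i F).degreeOf j ≤ F.degreeOf j :=
  degreeOf_coefv_le _ _ _ _

lemma degreeOf_pdiv_step_lt {i : Fin n} {F G : MvPolynomial (Fin n) K} (hF : 0 < F.degreeOf i)
    (hG : F.degreeOf i ≤ G.degreeOf i) :
    (lcv i F * G - coefv i (G.degreeOf i) G * X i ^ (G.degreeOf i - F.degreeOf i) * F).degreeOf i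
      < G.degreeOf i := by
  rw [← natDegree_partialEval_X i (_ - _)]
  have hC : ∀ (H : MvPolynomial (Fin n) K) d,
      partialEval (X : Fin n → MvPolynomial (Fin n) K) i (coefv i d H) =
        Polynomial.C (coefv i d H) := fun H d => by
    rw [partialEval_of_degreeOf_eq_zero _ (degreeOf_coefv_self H i d), aeval_X_left_apply]
  have hX : partialEval (K := K) (X : Fin n → MvPolynomial (Fin n) K) i (X i) = Polynomial.X := by
    simp [partialEval]
  rw [map_sub, map_mul, map_mul, map_mul, map_pow, hX, lcv, hC, hC]
  have hdF := natDegree_partialEval_le (X : Fin n → MvPolynomial (Fin n) K) i F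
  have hdG := natDegree_partialEval_le (X : Fin n → MvPolynomial (Fin n) K) i G
  have hcF := coeff_partialEval (X : Fin n → MvPolynomial (Fin n) K) i F
  have hcG := coeff_partialEval (X : Fin n → MvPolynomial (Fin n) K) i G
  generalize partialEval (X : Fin n → MvPolynomial (Fin n) K) i F = f at *
  generalize partialEval (X : Fin n → MvPolynomial (Fin n) K) i G = g at *
  simp only [aeval_X_left_apply] at hcF hcG
  refine lt_of_le_of_ne ?_ ?_
  · refine (Polynomial.natDegree_sub_le _ _).trans (max_le ?_ ?_)
    · exact (Polynomial.natDegree_C_mul_le _ _).trans hdG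
    · rw [mul_assoc]
      refine (Polynomial.natDegree_C_mul_le _ _).trans (Polynomial.natDegree_mul_le.trans ?_)
      rw [Polynomial.natDegree_X_pow]
      omega
  · intro h
    set p := Polynomial.C (coefv i (F.degreeOf i) F) * g -
      Polynomial.C (coefv i (G.degreeOf i) G) *
        Polynomial.X ^ (G.degreeOf i - F.degreeOf i) * f with hp
    have h0 : p.coeff (G.degreeOf i) = 0 := by
      rw [hp, mul_assoc, Polynomial.coeff_sub, Polynomial.coeff_C_mul, Polynomial.coeff_C_mul,
        Polynomial.coeff_X_pow_mul', if_pos (Nat.sub_le _ _), Nat.sub_sub_self hG, hcF, hcG]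
      ring
    rw [← h, Polynomial.coeff_natDegree, Polynomial.leadingCoeff_eq_zero] at h0
    rw [h0, Polynomial.natDegree_zero] at h
    omega

lemma exists_pdivAux_snd (i : Fin n) (F : MvPolynomial (Fin n) K) (q : ℕ) :
    ∀ QR : MvPolynomial (Fin n) K × MvPolynomial (Fin n) K,
      ∃ Q, (pdivAux i F q QR).2 = lcv i F ^ q * QR.2 - Q * F := by
  induction q with
  | zero => exact fun QR => ⟨0, by simp [pdivAux]⟩
  | succ q ih =>
    intro QR
    rw [pdivAux]
    split_ifs
    · exact ⟨0, by simp⟩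
    · obtain ⟨Q, hQ⟩ := ih (lcv i F * QR.1 +
            coefv i ((QR.2).degreeOf i) QR.2 * X i ^ ((QR.2).degreeOf i - F.degreeOf i),
          lcv i F * QR.2 -
            coefv i ((QR.2).degreeOf i) QR.2 * X i ^ ((QR.2).degreeOf i - F.degreeOf i) * F)
      exact ⟨Q + lcv i F ^ q *
        (coefv i ((QR.2).degreeOf i) QR.2 * X i ^ ((QR.2).degreeOf i - F.degreeOf i)), by
          rw [hQ]; ring⟩

lemma degreeOf_lcv_pow_mul_le {i j : Fin n} {F : MvPolynomial (Fin n) K}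
    (h : (lcv i F).degreeOf j = 0) (q : ℕ) (G : MvPolynomial (Fin n) K) :
    (lcv i F ^ q * G).degreeOf j ≤ G.degreeOf j := by
  have h1 := degreeOf_mul_le j (lcv i F ^ q) G
  have h2 := degreeOf_pow_le j (lcv i F) q
  rw [h, mul_zero] at h2
  omega

lemma degreeOf_pdivAux_lt {i : Fin n} {F : MvPolynomial (Fin n) K} (hF : 0 < F.degreeOf i)
    (q : ℕ) : ∀ QR : MvPolynomial (Fin n) K × MvPolynomial (Fin n) K,
      QR.2.degreeOf i + 1 ≤ q + F.degreeOf i →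
        (pdivAux i F q QR).2.degreeOf i < F.degreeOf i := by
  induction q with
  | zero => intro QR h; rw [pdivAux]; omega
  | succ q ih =>
    intro QR h
    rw [pdivAux]
    split_ifs with hlt
    · exact (degreeOf_lcv_pow_mul_le (degreeOf_coefv_self _ _ _) _ _).trans_lt hlt
    · refine ih _ ?_
      have := degreeOf_pdiv_step_lt hF (not_lt.1 hlt)
      dsimp only
      omega

lemma degreeOf_pdivAux_le {i j : Fin n} {F : MvPolynomial (Fin n) K} (hij : j ≠ i)
    (hF : F.degreeOf j = 0) (q : ℕ) :
    ∀ QR : MvPolynomial (Fin n) K × MvPolynomial (Fin n) K,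
      (pdivAux i F q QR).2.degreeOf j ≤ QR.2.degreeOf j := by
  have hl : (lcv i F).degreeOf j = 0 := by
    have := degreeOf_lcv_le F i j
    omega
  induction q with
  | zero => intro QR; rw [pdivAux]
  | succ q ih =>
    intro QR
    rw [pdivAux]
    split_ifs with hlt
    · exact degreeOf_lcv_pow_mul_le hl _ _
    · refine (ih _).trans ((degreeOf_sub_le _ _ _).trans (max_le ?_ ?_))
      · simpa using degreeOf_lcv_pow_mul_le hl 1 QR.2
      · have h1 := degreeOf_mul_le j (coefv i ((QR.2).degreeOf i) QR.2 *
          X i ^ ((QR.2).degreeOf i - F.degreeOf i)) F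
        have h2 := degreeOf_mul_le j (coefv i ((QR.2).degreeOf i) QR.2)
          (X i ^ ((QR.2).degreeOf i - F.degreeOf i))
        have h3 := degreeOf_coefv_le QR.2 i j ((QR.2).degreeOf i)
        have h4 := degreeOf_pow_le j (X i : MvPolynomial (Fin n) K)
          ((QR.2).degreeOf i - F.degreeOf i)
        rw [degreeOf_X, if_neg hij, mul_zero] at h4
        omega

lemma det_sylvester_eq_sign_mul_resultant {R : Type*} [CommRing R] (f g : Polynomial R)
    (m k : ℕ) : ∃ u : ℤˣ,
      (Matrix.of fun r c : Fin (m + k) =>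
        if (r : ℕ) < m then
          if (r : ℕ) ≤ (c : ℕ) ∧ (c : ℕ) ≤ (r : ℕ) + k then f.coeff (k + (r : ℕ) - (c : ℕ)) else 0
        else
          if (r : ℕ) - m ≤ (c : ℕ) ∧ (c : ℕ) ≤ (r : ℕ) then
            g.coeff (m + ((r : ℕ) - m) - (c : ℕ)) else 0).det =
        ((u : ℤ) : R) * Polynomial.resultant g f m k := by
  let σ : Equiv.Perm (Fin (m + k)) := finSumFinEquiv.symm.trans
    ((Equiv.sumCongr Fin.revPerm Fin.revPerm).trans finSumFinEquiv)
  let τ : Equiv.Perm (Fin (m + k)) := Fin.revPerm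
  refine ⟨Equiv.Perm.sign σ * Equiv.Perm.sign τ, ?_⟩
  rw [Polynomial.resultant, ← Matrix.det_transpose (Polynomial.sylvester _ _ _ _), Units.val_mul,
    Int.cast_mul, mul_assoc, ← Matrix.det_permute' τ, ← Matrix.det_permute σ]
  congr 1
  ext r c
  induction r using Fin.addCases with
  | left r =>
    have hr := r.2
    have hc := c.2
    simp only [Polynomial.sylvester, Matrix.of_apply, Matrix.submatrix_apply,
      Matrix.transpose_apply, σ, τ, Equiv.trans_apply, finSumFinEquiv_symm_apply_castAdd,
      Equiv.sumCongr_apply, Sum.map_inl, finSumFinEquiv_apply_left, Fin.addCases_left,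
      Fin.revPerm_apply, Fin.val_rev, Fin.val_castAdd, Set.mem_Icc, id_eq, if_pos hr]
    by_cases h : (r : ℕ) ≤ c ∧ (c : ℕ) ≤ r + k
    · rw [if_pos h, if_pos (by omega)]
      congr 1
      omega
    · rw [if_neg h, if_neg (by omega)]
  | right r =>
    have hr := r.2
    have hc := c.2
    simp only [Polynomial.sylvester, Matrix.of_apply, Matrix.submatrix_apply,
      Matrix.transpose_apply, σ, τ, Equiv.trans_apply, finSumFinEquiv_symm_apply_natAdd,
      Equiv.sumCongr_apply, Sum.map_inr, finSumFinEquiv_apply_right, Fin.addCases_right,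
      Fin.revPerm_apply, Fin.val_rev, Fin.val_natAdd, Set.mem_Icc, id_eq]
    rw [if_neg (by omega)]
    by_cases h : m + (r : ℕ) - m ≤ c ∧ (c : ℕ) ≤ m + r
    · rw [if_pos h, if_pos (by omega)]
      congr 1
      omega
    · rw [if_neg h, if_neg (by omega)]

/-- The resultant of `F` and `T` in `x_i` is nonzero at a point where the leading coefficient of
`T` does not vanish if and only if the specialisations of `F` and `T` have no common root. -/
lemma aeval_resv_ne_zero_iff {Ω : Type*} [Field Ω] [Algebra K Ω] [IsAlgClosed Ω]
    (a : Fin n → Ω) {i : Fin n} (F : MvPolynomial (Fin n) K) {T : MvPolynomial (Fin n) K}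
    (hT : aeval a (lcv i T) ≠ 0) :
    aeval a (resv F T i) ≠ 0 ↔ ∀ b, aeval (Function.update a i b) T = 0 →
      aeval (Function.update a i b) F ≠ 0 := by
  have hlc := coeff_partialEval a i T (T.degreeOf i)
  have hdeg : (partialEval a i T).natDegree = T.degreeOf i :=
    le_antisymm (natDegree_partialEval_le _ _ _)
      (Polynomial.le_natDegree_of_ne_zero (by rw [hlc]; exact hT))
  have hT0 : partialEval a i T ≠ 0 := by
    intro h
    rw [h, Polynomial.coeff_zero] at hlc
    exact hT hlc.symm
  obtain ⟨u, hu⟩ := det_sylvester_eq_sign_mul_resultant (partialEval a i F) (partialEval a i T)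
    (T.degreeOf i) (F.degreeOf i)
  have key : aeval a (resv F T i) = ((u : ℤ) : Ω) *
      Polynomial.resultant (partialEval a i T) (partialEval a i F)
        (T.degreeOf i) (F.degreeOf i) := by
    rw [← hu, resv, AlgHom.map_det]
    congr 1
    ext r c
    simp only [sylvester, AlgHom.mapMatrix_apply, Matrix.map_apply, Matrix.of_apply,
      coeff_partialEval, apply_ite (aeval a), map_zero]
  have hu0 : ((u : ℤ) : Ω) ≠ 0 := by
    rcases Int.units_eq_one_or u with rfl | rfl <;> simp
  rw [key, ← hdeg, Polynomial.resultant_eq_prod_eval _ _ _ (natDegree_partialEval_le _ _ _)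
    (IsAlgClosed.splits _), mul_ne_zero_iff, mul_ne_zero_iff]
  have h1 : (partialEval a i T).leadingCoeff ^ F.degreeOf i ≠ 0 :=
    pow_ne_zero _ (Polynomial.leadingCoeff_ne_zero.2 hT0)
  simp only [hu0, h1, ne_eq, not_false_eq_true, true_and, Multiset.prod_eq_zero_iff,
    Multiset.mem_map, Polynomial.mem_roots hT0, Polynomial.IsRoot.def, eval_partialEval]
  push Not
  rfl

/-- `x_i` is the leading variable of `F`. -/
def IsLv (F : MvPolynomial (Fin n) K) (i : Fin n) : Prop :=
  0 < F.degreeOf i ∧ ∀ j, i < j → F.degreeOf j = 0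

lemma mem_vars_iff_degreeOf_pos {F : MvPolynomial (Fin n) K} {i : Fin n} :
    i ∈ F.vars ↔ 0 < F.degreeOf i := by
  classical
  rw [vars_def, degreeOf_def, Multiset.mem_toFinset, Multiset.count_pos]

lemma IsLv.max'_eq {F : MvPolynomial (Fin n) K} {i : Fin n} (h : IsLv F i)
    (hne : F.vars.Nonempty) : F.vars.max' hne = i := by
  refine le_antisymm (Finset.max'_le _ _ _ fun j hj => ?_)
    (Finset.le_max' _ _ (mem_vars_iff_degreeOf_pos.2 h.1))
  by_contra hlt
  have := h.2 j (not_le.1 hlt)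
  have := mem_vars_iff_degreeOf_pos.1 hj
  omega

lemma IsLv.nonempty {F : MvPolynomial (Fin n) K} {i : Fin n} (h : IsLv F i) : F.vars.Nonempty :=
  ⟨i, mem_vars_iff_degreeOf_pos.2 h.1⟩

lemma IsLv.degLv_eq {F : MvPolynomial (Fin n) K} {i : Fin n} (h : IsLv F i)
    (G : MvPolynomial (Fin n) K) : degLv G F = G.degreeOf i := by
  rw [degLv, dif_pos h.nonempty, h.max'_eq]

lemma IsLv.ini_eq {F : MvPolynomial (Fin n) K} {i : Fin n} (h : IsLv F i) :
    ini F = lcv i F := by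
  rw [ini, dif_pos h.nonempty, h.max'_eq]

lemma IsLv.premLv_eq {F : MvPolynomial (Fin n) K} {i : Fin n} (h : IsLv F i)
    (G : MvPolynomial (Fin n) K) : premLv G F = prem G F i := by
  rw [premLv, dif_pos h.nonempty, h.max'_eq]

lemma IsLv.resLv_eq {F : MvPolynomial (Fin n) K} {i : Fin n} (h : IsLv F i)
    (G : MvPolynomial (Fin n) K) : resLv G F = resv G F i := by
  rw [resLv, dif_pos h.nonempty, h.max'_eq]

lemma IsLv.cls_eq {F : MvPolynomial (Fin n) K} {i : Fin n} (h : IsLv F i) :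
    cls F = (i : ℕ) + 1 := by
  refine le_antisymm (Finset.sup_le fun j hj => ?_)
    (Finset.le_sup (f := fun i : Fin n => (i : ℕ) + 1) (mem_vars_iff_degreeOf_pos.2 h.1))
  have := Finset.le_max' _ _ hj
  rw [h.max'_eq ⟨j, hj⟩, Fin.le_def] at this
  omega

lemma exists_isLv {F : MvPolynomial (Fin n) K} (h : 0 < cls F) : ∃ i, IsLv F i := by
  have hne : F.vars.Nonempty := by
    by_contra h0
    rw [Finset.not_nonempty_iff_eq_empty] at h0
    simp [cls, h0] at h
  refine ⟨F.vars.max' hne, mem_vars_iff_degreeOf_pos.1 (Finset.max'_mem _ _), fun j hj => ?_⟩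
  by_contra h0
  exact absurd (Finset.le_max' _ _ (mem_vars_iff_degreeOf_pos.2 (Nat.pos_of_ne_zero h0)))
    (not_le.2 hj)

lemma IsLv.eq_of_cls_eq {F G : MvPolynomial (Fin n) K} {i j : Fin n} (hF : IsLv F i)
    (hG : IsLv G j) (h : cls F = cls G) : i = j := by
  rw [hF.cls_eq, hG.cls_eq] at h
  exact Fin.ext (by omega)

/-- The zeros of `L` whose coordinates at the variables that lead no element of `L` are the
prescribed values `g`. -/
def zerosOver {Ω : Type*} [CommRing Ω] [Algebra K Ω] (g : Fin n → Ω)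
    (L : List (MvPolynomial (Fin n) K)) : Set (Fin n → Ω) :=
  {a | (∀ T ∈ L, aeval a T = 0) ∧ ∀ i, (∀ T ∈ L, ¬ IsLv T i) → a i = g i}

/-- Triangular sets whose initials vanish at none of the zeros, over the prescribed parameter
values `g`, of the preceding elements. -/
inductive RegularOver {Ω : Type*} [CommRing Ω] [Algebra K Ω] (g : Fin n → Ω) :
    List (MvPolynomial (Fin n) K) → Prop
  | nil : RegularOver g []
  | concat {L : List (MvPolynomial (Fin n) K)} {T : MvPolynomial (Fin n) K} {i : Fin n} :
      RegularOver g L → IsLv T i → (∀ S ∈ L, ∀ j, i ≤ j → S.degreeOf j = 0) →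
      (∀ a ∈ zerosOver g L, aeval a (lcv i T) ≠ 0) → RegularOver g (L ++ [T])

section Zeros

variable {Ω : Type*} [Field Ω] [Algebra K Ω] {g : Fin n → Ω}
  {L : List (MvPolynomial (Fin n) K)} {T : MvPolynomial (Fin n) K} {i : Fin n}

lemma update_mem_zerosOver_concat (hLi : ∀ S ∈ L, S.degreeOf i = 0) (hT : IsLv T i)
    {a : Fin n → Ω} (ha : a ∈ zerosOver g L) {b : Ω}
    (hb : aeval (Function.update a i b) T = 0) :
    Function.update a i b ∈ zerosOver g (L ++ [T]) := by
  refine ⟨fun S hS => ?_, fun j hj => ?_⟩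
  · rcases List.mem_append.1 hS with hS | hS
    · rw [aeval_update_of_degreeOf_eq_zero a (hLi S hS)]
      exact ha.1 S hS
    · rw [List.mem_singleton.1 hS]
      exact hb
  · have hji : j ≠ i := by
      rintro rfl
      exact hj T (by simp) hT
    rw [Function.update_of_ne hji]
    exact ha.2 j fun S hS => hj S (by simp [hS])

lemma update_mem_zerosOver_of_concat (hLi : ∀ S ∈ L, S.degreeOf i = 0) (hT : IsLv T i)
    {a : Fin n → Ω} (ha : a ∈ zerosOver g (L ++ [T])) :
    Function.update a i (g i) ∈ zerosOver g L := by
  refine ⟨fun S hS => ?_, fun j hj => ?_⟩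
  · rw [aeval_update_of_degreeOf_eq_zero a (hLi S hS)]
    exact ha.1 S (by simp [hS])
  · by_cases hji : j = i
    · subst hji; simp
    · rw [Function.update_of_ne hji]
      refine ha.2 j fun S hS => ?_
      rcases List.mem_append.1 hS with hS | hS
      · exact hj S hS
      · rw [List.mem_singleton.1 hS]
        intro h
        exact hji (h.eq_of_cls_eq hT rfl)

variable [IsAlgClosed Ω]

lemma resTS_ne_zero_iff (hg : AlgebraicIndependent K g) (hL : RegularOver g L) :
    ∀ F : MvPolynomial (Fin n) K, resTS F L ≠ 0 ↔ ∀ a ∈ zerosOver g L, aeval a F ≠ 0 := by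
  induction hL with
  | nil =>
    intro F
    have hz : zerosOver (K := K) g [] = {g} := by
      ext a
      simp [zerosOver, funext_iff]
    simp only [resTS, List.foldr_nil, hz, Set.mem_singleton_iff, forall_eq, ne_eq]
    rw [map_eq_zero_iff _ hg]
  | @concat L T i _ hT hLi hini ih =>
    intro F
    have hLi' : ∀ S ∈ L, S.degreeOf i = 0 := fun S hS => hLi S hS i le_rfl
    have : resTS F (L ++ [T]) = resTS (resv F T i) L := by
      rw [resTS, List.foldr_append, List.foldr_cons, List.foldr_nil, hT.resLv_eq, resTS]
    rw [this, ih]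
    constructor
    · intro h a ha
      have ha' := update_mem_zerosOver_of_concat hLi' hT ha
      have h1 := (aeval_resv_ne_zero_iff _ F (hini _ ha')).1 (h _ ha') (a i)
      simp only [Function.update_idem, Function.update_eq_self] at h1
      exact h1 (ha.1 T (by simp))
    · intro h a ha
      exact (aeval_resv_ne_zero_iff _ F (hini _ ha)).2 fun b hb =>
        h _ (update_mem_zerosOver_concat hLi' hT ha hb)

lemma RegularOver.zerosOver_nonempty (hL : RegularOver g L) : (zerosOver g L).Nonempty := by
  induction hL with
  | nil => exact ⟨g, by simp [zerosOver]⟩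
  | @concat L T i _ hT hLi hini ih =>
    obtain ⟨a, ha⟩ := ih
    have hdeg : (partialEval a i T).degree ≠ 0 := by
      refine ((WithBot.coe_lt_coe.2 hT.1).trans_le (Polynomial.le_degree_of_ne_zero ?_)).ne'
      rw [coeff_partialEval]
      exact hini a ha
    obtain ⟨b, hb⟩ := IsAlgClosed.exists_root _ hdeg
    rw [Polynomial.IsRoot.def, eval_partialEval] at hb
    exact ⟨_, update_mem_zerosOver_concat (fun S hS => hLi S hS i le_rfl) hT ha hb⟩

end Zeros

lemma isChain_cls_iff_pairwise {L : List (MvPolynomial (Fin n) K)} :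
    (L.IsChain fun A B => cls A < cls B) ↔ L.Pairwise fun A B => cls A < cls B :=
  haveI : IsTrans (MvPolynomial (Fin n) K) fun A B => cls A < cls B :=
    ⟨fun _ _ _ => lt_trans⟩
  List.isChain_iff_pairwise

section Regular

variable {Ω : Type*} [Field Ω] [Algebra K Ω] {g : Fin n → Ω}

lemma RegularOver.exists_isLv {L : List (MvPolynomial (Fin n) K)} (hL : RegularOver g L) :
    ∀ S ∈ L, ∃ i, IsLv S i := by
  induction hL with
  | nil => simp
  | @concat L T i _ hT hLi hini ih =>
    intro S hS
    rcases List.mem_append.1 hS with hS | hS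
    · exact ih S hS
    · rw [List.mem_singleton.1 hS]; exact ⟨i, hT⟩

lemma RegularOver.pairwise_cls {L : List (MvPolynomial (Fin n) K)} (hL : RegularOver g L) :
    L.Pairwise fun A B => cls A < cls B := by
  induction hL with
  | nil => simp
  | @concat L T i hL hT hLi hini ih =>
    refine List.pairwise_append.2 ⟨ih, by simp, fun S hS T' hT' => ?_⟩
    rw [List.mem_singleton.1 hT']
    obtain ⟨k, hk⟩ := hL.exists_isLv S hS
    rw [hk.cls_eq, hT.cls_eq]
    have : k < i := by
      by_contra h
      have := hLi S hS k (not_lt.1 h)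
      have := hk.1
      omega
    have := Fin.lt_def.1 this
    omega

variable [IsAlgClosed Ω]

lemma getD_concat_of_lt {α : Type*} {L : List α} (T d : α) {j : ℕ} (hj : j < L.length) :
    (L ++ [T]).getD j d = L.getD j d := by
  simp [List.getD_eq_getElem?_getD, List.getElem?_append_left hj]

lemma regularOver_of_resTS_ne_zero (hg : AlgebraicIndependent K g)
    (L : List (MvPolynomial (Fin n) K)) (hpos : ∀ T ∈ L, 0 < cls T)
    (hlt : L.Pairwise fun A B => cls A < cls B)
    (hres : ∀ j, 0 < j → j < L.length → resTS (ini (L.getD j 0)) (L.take j) ≠ 0) :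
    RegularOver g L := by
  induction L using List.reverseRecOn with
  | nil => exact .nil
  | append_singleton L T ih =>
    rw [List.pairwise_append] at hlt
    have hL := ih (fun S hS => hpos S (by simp [hS])) hlt.1 fun j h0 hj => by
      have := hres j h0 (by simp; omega)
      rwa [getD_concat_of_lt _ _ hj, List.take_append_of_le_length hj.le] at this
    obtain ⟨i, hi⟩ := exists_isLv (hpos T (by simp))
    refine .concat hL hi (fun S hS j hj => ?_) ?_
    · obtain ⟨k, hk⟩ := exists_isLv (hpos S (by simp [hS]))
      refine hk.2 j (lt_of_lt_of_le ?_ hj)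
      have := hlt.2.2 S hS T (by simp)
      rw [hk.cls_eq, hi.cls_eq] at this
      exact Fin.lt_def.2 (by omega)
    · rw [← resTS_ne_zero_iff hg hL, ← hi.ini_eq]
      rcases Nat.eq_zero_or_pos L.length with h0 | h0
      · rw [List.length_eq_zero_iff.1 h0, resTS, List.foldr_nil, hi.ini_eq]
        exact lcv_ne_zero hi.1
      · simpa using hres L.length h0 (by simp)

lemma RegularOver.resTS_ne_zero (hg : AlgebraicIndependent K g)
    {L : List (MvPolynomial (Fin n) K)} (hL : RegularOver g L) :
    ∀ j, j < L.length → resTS (ini (L.getD j 0)) (L.take j) ≠ 0 := by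
  induction hL with
  | nil => simp
  | @concat L T i hL hT hLi hini ih =>
    intro j hj
    simp only [List.length_append, List.length_singleton] at hj
    rcases Nat.lt_or_ge j L.length with h | h
    · rw [getD_concat_of_lt _ _ h, List.take_append_of_le_length h.le]
      exact ih j h
    · obtain rfl : j = L.length := by omega
      have h1 : (L ++ [T]).getD L.length 0 = T := by simp
      rw [h1, List.take_left, hT.ini_eq, resTS_ne_zero_iff hg hL]
      exact hini

lemma RegularOver.regularSet (hg : AlgebraicIndependent K g)
    {L : List (MvPolynomial (Fin n) K)} (hL : RegularOver g L) (hne : L ≠ []) :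
    RegularSet L := by
  refine ⟨⟨hne, fun T hT => ?_, isChain_cls_iff_pairwise.2 hL.pairwise_cls⟩,
    fun j _ hj => hL.resTS_ne_zero hg j hj⟩
  obtain ⟨i, hi⟩ := hL.exists_isLv T hT
  rw [hi.cls_eq]
  omega

lemma RegularSet.regularOver (hg : AlgebraicIndependent K g)
    {L : List (MvPolynomial (Fin n) K)} (hL : RegularSet L) : RegularOver g L :=
  regularOver_of_resTS_ne_zero hg L hL.1.2.1 (isChain_cls_iff_pairwise.1 hL.1.2.2) hL.2

end Regular

section PseudoRemainder

lemma premTS_cons (P T : MvPolynomial (Fin n) K) (L : List (MvPolynomial (Fin n) K)) :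
    premTS P (T :: L) = premLv (premTS P L) T := rfl

lemma exists_premTS_sub_mem_span {L : List (MvPolynomial (Fin n) K)}
    (hL : ∀ S ∈ L, ∃ i, IsLv S i) (P : MvPolynomial (Fin n) K) :
    ∃ H ∈ Submonoid.closure {p | ∃ S ∈ L, p = ini S},
      premTS P L - H * P ∈ Ideal.span {T | T ∈ L} := by
  induction L with
  | nil => exact ⟨1, one_mem _, by simp [premTS]⟩
  | cons T L ih =>
    obtain ⟨H, hH, hP⟩ := ih fun S hS => hL S (by simp [hS])
    obtain ⟨i, hi⟩ := hL T (by simp)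
    rw [premTS_cons, hi.premLv_eq, prem]
    obtain ⟨Q, hQ⟩ := exists_pdivAux_snd i T
      ((premTS P L).degreeOf i + 1 - T.degreeOf i) (0, premTS P L)
    generalize (premTS P L).degreeOf i + 1 - T.degreeOf i = q at *
    have hT : lcv i T ∈ Submonoid.closure {p | ∃ S ∈ T :: L, p = ini S} :=
      Submonoid.subset_closure ⟨T, by simp, hi.ini_eq.symm⟩
    refine ⟨lcv i T ^ q * H, mul_mem (pow_mem hT q) (Submonoid.closure_mono ?_ hH), ?_⟩
    · rintro p ⟨S, hS, rfl⟩
      exact ⟨S, by simp [hS], rfl⟩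
    · have h1 : premTS P L - H * P ∈ Ideal.span {S | S ∈ T :: L} :=
        Ideal.span_mono (fun S hS => List.mem_cons_of_mem _ hS) hP
      have h2 : T ∈ Ideal.span {S | S ∈ T :: L} := Ideal.subset_span (by simp)
      have : (pdivAux i T q (0, premTS P L)).2 - lcv i T ^ q * H * P =
          lcv i T ^ q * (premTS P L - H * P) - Q * T := by
        rw [hQ]; ring
      rw [this]
      exact sub_mem (Ideal.mul_mem_left _ _ h1) (Ideal.mul_mem_left _ _ h2)

lemma degreeOf_premLv_le {F : MvPolynomial (Fin n) K} (hF : ∃ i, IsLv F i) {j : Fin n}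
    (hj : F.degreeOf j = 0) (P : MvPolynomial (Fin n) K) :
    (premLv P F).degreeOf j ≤ P.degreeOf j := by
  obtain ⟨i, hi⟩ := hF
  rw [hi.premLv_eq]
  refine degreeOf_pdivAux_le ?_ hj _ _
  rintro rfl
  exact hi.1.ne' hj

lemma degreeOf_premTS_le {L : List (MvPolynomial (Fin n) K)} (hL : ∀ S ∈ L, ∃ i, IsLv S i)
    {j : Fin n} (hj : ∀ S ∈ L, S.degreeOf j = 0) (P : MvPolynomial (Fin n) K) :
    (premTS P L).degreeOf j ≤ P.degreeOf j := by
  induction L with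
  | nil => exact le_rfl
  | cons T L ih =>
    rw [premTS_cons]
    exact (degreeOf_premLv_le (hL T (by simp)) (hj T (by simp)) _).trans
      (ih (fun S hS => hL S (by simp [hS])) fun S hS => hj S (by simp [hS]))

lemma degreeOf_premTS_lt {L : List (MvPolynomial (Fin n) K)} (hL : ∀ S ∈ L, ∃ i, IsLv S i)
    (hlt : L.Pairwise fun A B => cls A < cls B) (P : MvPolynomial (Fin n) K) :
    ∀ S ∈ L, ∀ i, IsLv S i → (premTS P L).degreeOf i < S.degreeOf i := by
  induction L with
  | nil => simp
  | cons T L ih =>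
    intro S hS i hi
    rw [List.pairwise_cons] at hlt
    rw [premTS_cons]
    rcases List.mem_cons.1 hS with rfl | hS
    · rw [hi.premLv_eq]
      refine degreeOf_pdivAux_lt hi.1 _ _ ?_
      dsimp only
      omega
    · obtain ⟨k, hk⟩ := hL T (by simp)
      have := hlt.1 S hS
      rw [hi.cls_eq, hk.cls_eq] at this
      refine (degreeOf_premLv_le ⟨k, hk⟩ (hk.2 i (Fin.lt_def.2 (by omega))) _).trans_lt
        (ih (fun S hS => hL S (by simp [hS])) hlt.2 S hS i hi)

lemma mapIdx_premTS_concat (L : List (MvPolynomial (Fin n) K)) (T : MvPolynomial (Fin n) K) :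
    ((L ++ [T]).mapIdx fun j c => premTS c ((L ++ [T]).take j)) =
      (L.mapIdx fun j c => premTS c (L.take j)) ++ [premTS T L] := by
  rw [List.mapIdx_concat, List.take_left]
  congr 1
  rw [List.mapIdx_eq_mapIdx_iff]
  intro j hj
  rw [List.take_append_of_le_length hj.le]

lemma premTS_mem_of_mem {I : Ideal (MvPolynomial (Fin n) K)}
    {L : List (MvPolynomial (Fin n) K)} (hL : ∀ S ∈ L, ∃ i, IsLv S i) (hI : ∀ S ∈ L, S ∈ I)
    {P : MvPolynomial (Fin n) K} (hP : P ∈ I) : premTS P L ∈ I := by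
  obtain ⟨H, -, h⟩ := exists_premTS_sub_mem_span hL P
  have := add_mem (Ideal.span_le.2 hI h) (I.mul_mem_left H hP)
  rwa [sub_add_cancel] at this

/-- The two polynomials have the same leading variable and the same degree in it. -/
def SameRank (A B : MvPolynomial (Fin n) K) : Prop :=
  ∃ i, IsLv A i ∧ IsLv B i ∧ A.degreeOf i = B.degreeOf i

variable {Ω : Type*} [Field Ω] [Algebra K Ω] {g : Fin n → Ω}

lemma exists_partialEval_premTS {L : List (MvPolynomial (Fin n) K)} (hL : RegularOver g L)
    {i : Fin n} (hi : ∀ S ∈ L, S.degreeOf i = 0) {a : Fin n → Ω} (ha : a ∈ zerosOver g L)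
    (P : MvPolynomial (Fin n) K) :
    ∃ c ≠ 0, partialEval a i (premTS P L) = Polynomial.C c * partialEval a i P := by
  have hlv := hL.exists_isLv
  have hini : ∀ S ∈ L, aeval a (ini S) ≠ 0 := by
    clear hi hlv
    induction hL generalizing a with
    | nil => simp
    | @concat L T i _ hT hLi hini ih =>
      intro S hS
      have ha' := update_mem_zerosOver_of_concat (fun S hS => hLi S hS i le_rfl) hT ha
      have key : ∀ F : MvPolynomial (Fin n) K, F.degreeOf i = 0 →
          aeval (Function.update a i (g i)) F ≠ 0 → aeval a F ≠ 0 := fun F hF h => by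
        rwa [aeval_update_of_degreeOf_eq_zero _ hF] at h
      rcases List.mem_append.1 hS with hS | hS
      · refine key _ ?_ (ih ha' S hS)
        have h0 := hLi S hS i le_rfl
        rw [ini]
        split_ifs
        · have := degreeOf_lcv_le S (S.vars.max' ‹_›) i
          omega
        · exact h0
      · rw [List.mem_singleton.1 hS, hT.ini_eq]
        exact key _ (degreeOf_coefv_self _ _ _) (hini _ ha')
  obtain ⟨H, hH, h⟩ := exists_premTS_sub_mem_span hlv P
  have h0 : partialEval a i (premTS P L - H * P) = 0 := by
    have hle : Ideal.span {T | T ∈ L} ≤ RingHom.ker (partialEval a i).toRingHom := by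
      refine Ideal.span_le.2 fun S hS => ?_
      change partialEval a i S = 0
      rw [partialEval_of_degreeOf_eq_zero a (hi S hS), ha.1 S hS, Polynomial.C_0]
    exact hle h
  have hc : ∃ c ≠ 0, partialEval a i H = Polynomial.C c := by
    clear h h0
    induction hH using Submonoid.closure_induction with
    | mem p hp =>
      obtain ⟨S, hS, rfl⟩ := hp
      refine ⟨_, hini S hS, partialEval_of_degreeOf_eq_zero a ?_⟩
      obtain ⟨k, hk⟩ := hlv S hS
      have := degreeOf_lcv_le S k i
      rw [hi S hS] at this
      rw [hk.ini_eq]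
      omega
    | one => exact ⟨1, one_ne_zero, by simp⟩
    | mul x y _ _ hx hy =>
      obtain ⟨c, hc, hx⟩ := hx
      obtain ⟨d, hd, hy⟩ := hy
      exact ⟨c * d, mul_ne_zero hc hd, by rw [map_mul, hx, hy, Polynomial.C_mul]⟩
  obtain ⟨c, hc, hcH⟩ := hc
  refine ⟨c, hc, ?_⟩
  rwa [map_sub, map_mul, hcH, sub_eq_zero] at h0

/-- Replacing the elements of a regular set by their pseudo-remainders with respect to the
preceding elements changes neither its zeros nor its ranks and makes it reduced. -/
theorem RegularOver.mapIdx_premTS [IsAlgClosed Ω] {L : List (MvPolynomial (Fin n) K)} (hL : RegularOver g L) :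
    RegularOver g (L.mapIdx fun j c => premTS c (L.take j)) ∧
      zerosOver g (L.mapIdx fun j c => premTS c (L.take j)) = zerosOver g L ∧
      List.Forall₂ SameRank L (L.mapIdx fun j c => premTS c (L.take j)) ∧
      (L.mapIdx fun j c => premTS c (L.take j)).Pairwise fun A B => RReduced B A := by
  induction hL with
  | nil => exact ⟨.nil, rfl, .nil, .nil⟩
  | @concat L T i hL hT hLi hini ih =>
    rw [mapIdx_premTS_concat]
    obtain ⟨hs, hz, hr, hp⟩ := ih
    generalize (L.mapIdx fun j c => premTS c (L.take j)) = s at *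
    have hLi' : ∀ S ∈ L, S.degreeOf i = 0 := fun S hS => hLi S hS i le_rfl
    have hex : ∀ A ∈ s, ∃ S ∈ L, SameRank S A := fun A hA => by
      obtain ⟨j, hj, rfl⟩ := List.getElem_of_mem hA
      have hj' : j < L.length := by rw [hr.length_eq]; exact hj
      exact ⟨L[j], List.getElem_mem _, (List.forall₂_iff_get.1 hr).2 j hj' hj⟩
    have hsi : ∀ A ∈ s, ∀ j, i ≤ j → A.degreeOf j = 0 := by
      intro A hA j hj
      obtain ⟨S, hS, k, hk, hkA, -⟩ := hex A hA
      refine hkA.2 j (lt_of_lt_of_le ?_ hj)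
      by_contra h
      exact hk.1.ne' (hLi S hS k (not_lt.1 h))
    have hev := fun a (ha : a ∈ zerosOver g L) => exists_partialEval_premTS hL hLi' ha T
    have hle := degreeOf_premTS_le hL.exists_isLv hLi' T
    have hcoef : ∀ a ∈ zerosOver g L, aeval a (coefv i (T.degreeOf i) (premTS T L)) ≠ 0 := by
      intro a ha
      obtain ⟨c, hc, h⟩ := hev a ha
      rw [← coeff_partialEval, h, Polynomial.coeff_C_mul, coeff_partialEval]
      exact mul_ne_zero hc (hini a ha)
    have hdeg : (premTS T L).degreeOf i = T.degreeOf i := by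
      refine le_antisymm hle (not_lt.1 fun hlt => ?_)
      obtain ⟨a, ha⟩ := hL.zerosOver_nonempty
      exact hcoef a ha (by rw [coefv_eq_zero hlt, map_zero])
    have hT' : IsLv (premTS T L) i := by
      refine ⟨hdeg ▸ hT.1, fun j hj => ?_⟩
      have := degreeOf_premTS_le hL.exists_isLv (fun S hS => hLi S hS j hj.le) T
      rw [hT.2 j hj] at this
      omega
    have hzero : ∀ a ∈ zerosOver g L, ∀ b,
        aeval (Function.update a i b) (premTS T L) = 0 ↔
          aeval (Function.update a i b) T = 0 := by
      intro a ha b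
      obtain ⟨c, hc, h⟩ := hev a ha
      rw [← eval_partialEval, h, Polynomial.eval_mul, Polynomial.eval_C, eval_partialEval,
        mul_eq_zero_iff_left hc]
    refine ⟨hs.concat hT' hsi ?_, ?_, ?_, ?_⟩
    · rw [hz, lcv, hdeg]
      exact hcoef
    · ext a
      constructor
      · intro ha
        have ha' := update_mem_zerosOver_of_concat (fun S hS => hsi S hS i le_rfl) hT' ha
        rw [hz] at ha'
        have h1 := ha.1 (premTS T L) (by simp)
        have h2 := hzero _ ha' (a i)
        simp only [Function.update_idem, Function.update_eq_self] at h2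
        have := update_mem_zerosOver_concat hLi' hT ha' (b := a i)
        simp only [Function.update_idem, Function.update_eq_self] at this
        exact this (h2.1 h1)
      · intro ha
        have ha' := update_mem_zerosOver_of_concat hLi' hT ha
        have h1 := ha.1 T (by simp)
        have h2 := hzero _ ha' (a i)
        rw [← hz] at ha'
        simp only [Function.update_idem, Function.update_eq_self] at h2
        have := update_mem_zerosOver_concat (fun S hS => hsi S hS i le_rfl) hT' ha' (b := a i)
        simp only [Function.update_idem, Function.update_eq_self] at this
        exact this (h2.2 h1)
    · exact List.rel_append hr (.cons ⟨i, hT, hT', hdeg.symm⟩ .nil)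
    · refine List.pairwise_append.2 ⟨hp, by simp, fun A hA B hB => ?_⟩
      rw [List.mem_singleton.1 hB]
      obtain ⟨S, hS, k, hk, hkA, hkd⟩ := hex A hA
      rw [RReduced, hkA.degLv_eq, hkA.degLv_eq, ← hkd]
      exact degreeOf_premTS_lt hL.exists_isLv hL.pairwise_cls T S hS k hk

end PseudoRemainder

section Minimality

lemma IsLpp.apply_eq_degreeOf {F : MvPolynomial (Fin n) K} {m : Fin n →₀ ℕ} (hm : IsLpp F m)
    {i : Fin n} (hi : IsLv F i) : m i = F.degreeOf i := by
  refine le_antisymm (monomial_le_degreeOf i hm.1) (degreeOf_le_iff.2 fun m' hm' => ?_)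
  by_cases he : m' = m
  · rw [he]
  obtain ⟨k, hk, hkj⟩ := hm.2 m' hm' he
  rcases lt_trichotomy k i with h | rfl | h
  · exact (hkj i h).le
  · exact hk.le
  · have h1 := monomial_le_degreeOf k hm.1
    rw [hi.2 k h] at h1
    omega

/-- A nonzero member of the ideal is not reduced with respect to a W-characteristic set. -/
lemma exists_degreeOf_le_of_isWCharSet {I : Ideal (MvPolynomial (Fin n) K)}
    {Cs : List (MvPolynomial (Fin n) K)} (hW : IsWCharSet I Cs) (hpos : ∀ c ∈ Cs, 0 < cls c)
    {F : MvPolynomial (Fin n) K} (hF : F ∈ I) (hF0 : F ≠ 0) :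
    ∃ c ∈ Cs, ∃ i, IsLv c i ∧ c.degreeOf i ≤ F.degreeOf i := by
  obtain ⟨G, hG, -, -, hcov, hmin⟩ := hW
  obtain ⟨g, hg, mg, mF, hmg, hmF, hle⟩ := hG.2.1 F hF hF0
  obtain ⟨c, hc, hcg⟩ := hcov g hg
  obtain ⟨i, hi⟩ := exists_isLv (hpos c hc)
  obtain ⟨k, hk⟩ := exists_isLv (hcg ▸ hpos c hc : 0 < cls g)
  obtain rfl := hi.eq_of_cls_eq hk hcg
  refine ⟨c, hc, i, hi, le_trans ?_ ((hle i).trans (monomial_le_degreeOf i hmF.1))⟩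
  rw [hmg.apply_eq_degreeOf hk]
  by_cases hgc : g = c
  · rw [hgc]
  obtain ⟨mc, mg', hmc, hmg', j, hj, hlt⟩ := hmin c hc g hg hcg.symm hgc
  rw [← hmc.apply_eq_degreeOf hi, ← hmg'.apply_eq_degreeOf hk]
  rcases lt_trichotomy j i with h | rfl | h
  · exact (hlt i h).le
  · exact hj.le
  · have h1 := monomial_le_degreeOf j hmg'.1
    rw [hk.2 j h] at h1
    omega

lemma degreeOf_eq_of_rkEQ {A B : MvPolynomial (Fin n) K} {i : Fin n} (hA : IsLv A i)
    (hB : 0 < cls B) (h : rkEQ A B) : IsLv B i ∧ A.degreeOf i = B.degreeOf i := by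
  obtain ⟨k, hk⟩ := exists_isLv hB
  obtain ⟨h1, h2⟩ := h
  simp only [rkLT, hA.degLv_eq, hk.degLv_eq, not_or, not_and] at h1 h2
  have hcls : cls A = cls B := by omega
  obtain rfl := hA.eq_of_cls_eq hk hcls
  refine ⟨hk, ?_⟩
  have := h1.2 hcls (by omega)
  have := h2.2 hcls.symm hB
  omega

/-- An ascending set in a proper ideal is a characteristic set if no nonzero member of the ideal
is reduced with respect to it. -/
lemma rittCharSet_of_exists_degreeOf_le {I : Ideal (MvPolynomial (Fin n) K)} (hI : I ≠ ⊤)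
    {A : List (MvPolynomial (Fin n) K)} (hA : TriangularSet A)
    (hred : A.Pairwise fun A B => RReduced B A) (hAI : ∀ a ∈ A, a ∈ I)
    (h : ∀ F ∈ I, F ≠ 0 → ∃ T ∈ A, ∃ i, IsLv T i ∧ T.degreeOf i ≤ F.degreeOf i) :
    RittCharSet I A := by
  refine ⟨Or.inr ⟨hA, hred⟩, hAI, fun B hB hBI hlt => ?_⟩
  rcases hB with ⟨a, ha, rfl⟩ | ⟨hB, hBred⟩
  · refine hI (Ideal.eq_top_of_isUnit_mem _ (hBI (C a) (by simp)) ?_)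
    exact (isUnit_iff_ne_zero.2 ha).map C
  have hAlt := isChain_cls_iff_pairwise.1 hA.2.2
  have hcommon : ∃ j, ∃ hj : j < B.length,
      (∀ i, i < j → i < A.length ∧ rkEQ (A.getD i 0) (B.getD i 0)) ∧
        (∀ hjA : j < A.length, rkLT B[j] A[j]) := by
    rcases hlt with ⟨j, hj, heq, hrk⟩ | ⟨hlen, heq⟩
    · have hjA : j < A.length := by omega
      have hjB : j < B.length := by omega
      refine ⟨j, hjB, fun i hi => ⟨by omega, heq i hi⟩, fun _ => ?_⟩
      simpa [List.getD_eq_getElem?_getD, hjA, hjB] using hrk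
    · exact ⟨A.length, hlen, fun i hi => ⟨hi, heq i hi⟩, fun h => absurd h (lt_irrefl _)⟩
  obtain ⟨j, hj, heq, hrk⟩ := hcommon
  have hBpos := hB.2.1 B[j] (List.getElem_mem _)
  obtain ⟨p, hp⟩ := exists_isLv hBpos
  obtain ⟨T, hT, i, hi, hle⟩ := h B[j] (hBI _ (List.getElem_mem _))
    (ne_zero_of_degreeOf_ne_zero hp.1.ne')
  obtain ⟨k, hk, rfl⟩ := List.getElem_of_mem hT
  have hip : i ≤ p := by
    by_contra hlt
    have := hp.2 i (not_le.1 hlt)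
    have := hi.1
    omega
  rcases Nat.lt_or_ge k j with hkj | hkj
  · have hkB : k < B.length := by omega
    have h1 := (heq k hkj).2
    rw [List.getD_eq_getElem _ _ hk, List.getD_eq_getElem _ _ hkB] at h1
    obtain ⟨h2, h3⟩ := degreeOf_eq_of_rkEQ hi (hB.2.1 _ (List.getElem_mem _)) h1
    have h4 := List.pairwise_iff_getElem.1 hBred k j hkB hj hkj
    rw [RReduced, h2.degLv_eq, h2.degLv_eq] at h4
    omega
  · have hjA : j < A.length := by omega
    have hAk : cls A[j] ≤ cls A[k] := by
      rcases hkj.lt_or_eq with hlt | rfl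
      · exact (List.pairwise_iff_getElem.1 hAlt j k hjA hk hlt).le
      · exact le_rfl
    have hkB : cls A[k] ≤ cls B[j] := by
      rw [hi.cls_eq, hp.cls_eq]
      have := Fin.le_def.1 hip
      omega
    rcases hrk hjA with hlt | ⟨hcls, -, hlt⟩
    · omega
    · have hkj' : k = j := by
        by_contra hne
        have := List.pairwise_iff_getElem.1 hAlt j k hjA hk (by omega)
        omega
      subst hkj'
      obtain rfl := hi.eq_of_cls_eq hp hcls.symm
      rw [hp.degLv_eq, hi.degLv_eq] at hlt
      omega

end Minimality

lemma algebraicIndependent_algebraMap_X :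
    AlgebraicIndependent K fun i : Fin n =>
      algebraMap (MvPolynomial (Fin n) K)
        (AlgebraicClosure (FractionRing (MvPolynomial (Fin n) K))) (X i) := by
  have hinj : Function.Injective (algebraMap (MvPolynomial (Fin n) K)
      (AlgebraicClosure (FractionRing (MvPolynomial (Fin n) K)))) := by
    rw [IsScalarTower.algebraMap_eq _ (FractionRing (MvPolynomial (Fin n) K))]
    exact (algebraMap (FractionRing (MvPolynomial (Fin n) K)) _).injective.comp
      (IsFractionRing.injective _ _)
  exact (algebraicIndependent_X (Fin n) K).map'
    (f := IsScalarTower.toAlgHom K (MvPolynomial (Fin n) K) _) hinj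

/-- Theorem rittcsthm. Let `C = [C_1, …, C_r]` be the W-characteristic
set of `⟨P⟩`. If `C` is regular, then
`C* = [C_1, prem(C_2, [C_1]), …, prem(C_r, [C_1, …, C_{r−1}])]` is a Ritt characteristic
set of `⟨P⟩`, and `C*` is also regular. -/
theorem statement11 {n : ℕ} {K : Type*} [Field K]
    (P : Finset (MvPolynomial (Fin n) K)) (hne : P.Nonempty) (h0 : ∀ p ∈ P, p ≠ 0)
    (hproper : Ideal.span (P : Set (MvPolynomial (Fin n) K)) ≠ ⊤)
    (Cs : List (MvPolynomial (Fin n) K))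
    (hW : IsWCharSet (Ideal.span (P : Set (MvPolynomial (Fin n) K))) Cs)
    (hreg : RegularSet Cs) :
    RittCharSet (Ideal.span (P : Set (MvPolynomial (Fin n) K)))
        (Cs.mapIdx fun j c => premTS c (Cs.take j)) ∧
      RegularSet (Cs.mapIdx fun j c => premTS c (Cs.take j)) := by
  have hg := algebraicIndependent_algebraMap_X (n := n) (K := K)
  have hR := hreg.regularOver hg
  obtain ⟨hs, -, hr, hp⟩ := hR.mapIdx_premTS
  have hreg' := hs.regularSet hg (by simpa using hreg.1.1)
  refine ⟨rittCharSet_of_exists_degreeOf_le hproper hreg'.1 hp ?_ ?_, hreg'⟩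
  · have hCI : ∀ c ∈ Cs, c ∈ Ideal.span (P : Set (MvPolynomial (Fin n) K)) := by
      obtain ⟨G, hG, -, hCG, -⟩ := hW
      exact fun c hc => (hG.1 c (hCG c hc)).1
    intro a ha
    obtain ⟨j, hj, rfl⟩ := List.mem_mapIdx.1 ha
    exact premTS_mem_of_mem (fun S hS => hR.exists_isLv S (List.mem_of_mem_take hS))
      (fun S hS => hCI S (List.mem_of_mem_take hS)) (hCI _ (List.getElem_mem _))
  · intro F hF hF0
    obtain ⟨c, hc, i, hi, hle⟩ := exists_degreeOf_le_of_isWCharSet hW hreg.1.2.1 hF hF0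
    obtain ⟨j, hj, rfl⟩ := List.getElem_of_mem hc
    obtain ⟨hlen, hget⟩ := List.forall₂_iff_get.1 hr
    obtain ⟨k, hk, hk', hd⟩ := hget j hj (hlen ▸ hj)
    obtain rfl := hk.eq_of_cls_eq hi rfl
    exact ⟨_, List.get_mem _ _, k, hk', hd ▸ hle⟩

end CharSets
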